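/- arXiv:math/0606325 — 7 statements merged into one kernel-verified Lean document; each statement's English description precedes it below -/
import Mathlib

section
/- Let n ≥ 1 and let T be an (n+3)×(n+3) real matrix in O(n+1,2) (acting on row vectors) satisfying ℘T = ℘. Then there exist a row vector a ∈ ℝⁿ, real numbers ρ, w, an n×n matrix A, a column vector u ∈ ℝⁿ and a row vector v ∈ ℝⁿ, with the (n+1)×(n+1) block matrix [[A, u],[v, w]] lying in O(n,1), such that T equals the block matrix whose first row is (1+|a|²/2−ρ²/2, −|a|²/2+ρ²/2, a, ρ), whose second row is (|a|²/2−ρ²/2, 1−|a|²/2+ρ²/2, a, ρ), whose middle n rows are (Aaᵀ−ρu, −Aaᵀ+ρu, A, u), and whose last row is (vaᵀ−ρw, −vaᵀ+ρw, v, w). -/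
open Matrix

noncomputable section

/-- The row vector `(c0, c1, mid, clast)` in `ℝ^{n+3}`. -/
def emb (n : ℕ) (c0 c1 : ℝ) (mid : Fin n → ℝ) (clast : ℝ) : Fin (n + 3) → ℝ :=
  fun j =>
    if _h0 : j.val = 0 then c0
    else if _h1 : j.val = 1 then c1
    else if _h2 : j.val = n + 2 then clast
    else mid ⟨j.val - 2, by have := j.isLt; omega⟩

/-- The bilinear form `⟨X,Y⟩ = -X₁Y₁ + X₂Y₂ + ⋯ + X_{n+2}Y_{n+2} - X_{n+3}Y_{n+3}` of
signature `(n+1,2)` on `ℝ^{n+3}`. -/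
def form2 (n : ℕ) (X Y : Fin (n + 3) → ℝ) : ℝ :=
  ∑ i, (if i.val = 0 ∨ i.val = n + 2 then (-1 : ℝ) else 1) * X i * Y i

/-- `℘ = (1, -1, 0, …, 0, 0)`. -/
def wp (n : ℕ) : Fin (n + 3) → ℝ := emb n 1 (-1) 0 0

/-- Membership in `O(n+1,2)` (matrices acting on row vectors on the right). -/
def isO2 (n : ℕ) (T : Matrix (Fin (n + 3)) (Fin (n + 3)) ℝ) : Prop :=
  ∀ X Y : Fin (n + 3) → ℝ, form2 n (X ᵥ* T) (Y ᵥ* T) = form2 n X Y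

/-- The Lorentzian form `x₁y₁ + ⋯ + xₙyₙ - x_{n+1}y_{n+1}` on `ℝ^{n+1}`. -/
def form1 (n : ℕ) (X Y : Fin (n + 1) → ℝ) : ℝ :=
  ∑ i, (if i.val = n then (-1 : ℝ) else 1) * X i * Y i

/-- Membership in `O(n,1)`. -/
def isO1 (n : ℕ) (S : Matrix (Fin (n + 1)) (Fin (n + 1)) ℝ) : Prop :=
  ∀ X Y : Fin (n + 1) → ℝ, form1 n (X ᵥ* S) (Y ᵥ* S) = form1 n X Y

/-- The block matrix `[[A, u], [v, w]]` of size `(n+1)×(n+1)`. -/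
def blk (n : ℕ) (A : Matrix (Fin n) (Fin n) ℝ) (u v : Fin n → ℝ) (w : ℝ) :
    Matrix (Fin (n + 1)) (Fin (n + 1)) ℝ :=
  Matrix.of fun i j =>
    if _hi : i.val = n then
      (if _hj : j.val = n then w else v ⟨j.val, by have := j.isLt; omega⟩)
    else
      (if _hj : j.val = n then u ⟨i.val, by have := i.isLt; omega⟩
       else A ⟨i.val, by have := i.isLt; omega⟩ ⟨j.val, by have := j.isLt; omega⟩)

/-- The `(n+3)×(n+3)` matrix with rows `(1+|a|²/2-ρ²/2, -|a|²/2+ρ²/2, a, ρ)`,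
`(|a|²/2-ρ²/2, 1-|a|²/2+ρ²/2, a, ρ)`, `(Aaᵀ-ρu, -Aaᵀ+ρu, A, u)` and
`(vaᵀ-ρw, -vaᵀ+ρw, v, w)`. -/
def bigT (n : ℕ) (A : Matrix (Fin n) (Fin n) ℝ) (u v : Fin n → ℝ) (w : ℝ)
    (a : Fin n → ℝ) (ρ : ℝ) : Matrix (Fin (n + 3)) (Fin (n + 3)) ℝ :=
  Matrix.of fun i =>
    if _h0 : i.val = 0 then
      emb n (1 + (a ⬝ᵥ a) / 2 - ρ ^ 2 / 2) (-((a ⬝ᵥ a) / 2) + ρ ^ 2 / 2) a ρ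
    else if _h1 : i.val = 1 then
      emb n ((a ⬝ᵥ a) / 2 - ρ ^ 2 / 2) (1 - (a ⬝ᵥ a) / 2 + ρ ^ 2 / 2) a ρ
    else if _h2 : i.val = n + 2 then
      emb n ((v ⬝ᵥ a) - ρ * w) (-(v ⬝ᵥ a) + ρ * w) v w
    else
      let k : Fin n := ⟨i.val - 2, by have := i.isLt; omega⟩
      emb n ((A *ᵥ a) k - ρ * u k) (-((A *ᵥ a) k) + ρ * u k) (A k) (u k)

/-- A property of the coordinates of `ℝ^{n+3}` can be checked on the first two, the middle `n`
and the last one. -/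
theorem forall_fin_add_three {n : ℕ} {P : Fin (n + 3) → Prop} (h0 : P 0) (h1 : P 1)
    (hmid : ∀ k : Fin n, P k.castSucc.succ.succ) (hlast : P (Fin.last n).succ.succ) :
    ∀ i, P i := by
  intro i
  refine Fin.cases h0 (fun i => ?_) i
  refine Fin.cases h1 (fun i => ?_) i
  exact Fin.lastCases hlast hmid i

section emb

variable (n : ℕ) (c0 c1 : ℝ) (mid : Fin n → ℝ) (clast : ℝ)

@[simp] theorem emb_zero : emb n c0 c1 mid clast 0 = c0 := by simp [emb]

@[simp] theorem emb_one : emb n c0 c1 mid clast 1 = c1 := by simp [emb]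

@[simp] theorem emb_mid (k : Fin n) : emb n c0 c1 mid clast k.castSucc.succ.succ = mid k := by
  simp [emb, k.isLt.ne]

@[simp] theorem emb_last : emb n c0 c1 mid clast (Fin.last n).succ.succ = clast := by
  simp [emb, -Fin.succ_last]

theorem eq_emb_iff (X : Fin (n + 3) → ℝ) :
    X = emb n c0 c1 mid clast ↔ X 0 = c0 ∧ X 1 = c1 ∧
      (∀ k : Fin n, X k.castSucc.succ.succ = mid k) ∧ X (Fin.last n).succ.succ = clast := by
  constructor
  · rintro rfl
    simp [-Fin.succ_last]
  · rintro ⟨h0, h1, hmid, hlast⟩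
    funext j
    exact forall_fin_add_three (P := fun j => X j = emb n c0 c1 mid clast j)
      (by simpa using h0) (by simpa using h1) (fun k => by simpa using hmid k)
      (by simpa [-Fin.succ_last] using hlast) j

end emb

section bigT

variable (n : ℕ) (A : Matrix (Fin n) (Fin n) ℝ) (u v : Fin n → ℝ) (w : ℝ) (a : Fin n → ℝ) (ρ : ℝ)

theorem bigT_zero : bigT n A u v w a ρ 0 =
    emb n (1 + (a ⬝ᵥ a) / 2 - ρ ^ 2 / 2) (-((a ⬝ᵥ a) / 2) + ρ ^ 2 / 2) a ρ := rfl

theorem bigT_one : bigT n A u v w a ρ 1 =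
    emb n ((a ⬝ᵥ a) / 2 - ρ ^ 2 / 2) (1 - (a ⬝ᵥ a) / 2 + ρ ^ 2 / 2) a ρ := by
  funext j
  simp [bigT]

theorem bigT_mid (k : Fin n) : bigT n A u v w a ρ k.castSucc.succ.succ =
    emb n ((A *ᵥ a) k - ρ * u k) (-((A *ᵥ a) k) + ρ * u k) (A k) (u k) := by
  funext j
  simp [bigT, k.isLt.ne]

theorem bigT_last : bigT n A u v w a ρ (Fin.last n).succ.succ =
    emb n ((v ⬝ᵥ a) - ρ * w) (-(v ⬝ᵥ a) + ρ * w) v w := by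
  funext j
  simp [bigT]

end bigT

theorem form1_eq (n : ℕ) (X Y : Fin (n + 1) → ℝ) :
    form1 n X Y = (fun k : Fin n => X k.castSucc) ⬝ᵥ (fun k : Fin n => Y k.castSucc)
      - X (Fin.last n) * Y (Fin.last n) := by
  simp [form1, Fin.sum_univ_castSucc, dotProduct, Fin.val_castSucc, (Fin.isLt _).ne,
    sub_eq_add_neg]

theorem form2_eq (n : ℕ) (X Y : Fin (n + 3) → ℝ) :
    form2 n X Y = -(X 0 * Y 0) + X 1 * Y 1
      + form1 n (fun i => X i.succ.succ) (fun i => Y i.succ.succ) := by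
  simp [form2, form1, Fin.sum_univ_succ (n := n + 2), Fin.sum_univ_succ (n := n + 1), add_assoc]

theorem form2_wp (n : ℕ) (X : Fin (n + 3) → ℝ) : form2 n X (wp n) = -(X 0 + X 1) := by
  simp [form2_eq, form1_eq, wp, dotProduct, -Fin.succ_last]
  ring

theorem wp_vecMul (n : ℕ) (T : Matrix (Fin (n + 3)) (Fin (n + 3)) ℝ) :
    wp n ᵥ* T = T 0 - T 1 := by
  funext j
  simp [vecMul, dotProduct, Fin.sum_univ_succ (n := n + 2), Fin.sum_univ_succ (n := n + 1),
    Fin.sum_univ_castSucc, wp, sub_eq_add_neg, -Fin.succ_last]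

theorem blk_submatrix (n : ℕ) (S : Matrix (Fin (n + 1)) (Fin (n + 1)) ℝ) :
    blk n (fun i j => S i.castSucc j.castSucc) (fun i => S i.castSucc (Fin.last n))
      (fun j => S (Fin.last n) j.castSucc) (S (Fin.last n) (Fin.last n)) = S := by
  ext i j
  refine Fin.lastCases ?_ (fun i => ?_) i <;> refine Fin.lastCases ?_ (fun j => ?_) j <;>
    simp [blk, (Fin.isLt _).ne]

/-- An element of `O(n+1,2)` fixing `℘` preserves the pairing with `℘`. -/
theorem isO2.vecMul_zero_add_one {n : ℕ} {T : Matrix (Fin (n + 3)) (Fin (n + 3)) ℝ}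
    (hT : isO2 n T) (hwp : wp n ᵥ* T = wp n) (X : Fin (n + 3) → ℝ) :
    (X ᵥ* T) 0 + (X ᵥ* T) 1 = X 0 + X 1 := by
  have h := hT X (wp n)
  rw [hwp, form2_wp, form2_wp] at h
  linarith

/-- The lower right block of an element of `O(n+1,2)` fixing `℘` lies in `O(n,1)`. -/
theorem isO2.isO1_submatrix {n : ℕ} {T : Matrix (Fin (n + 3)) (Fin (n + 3)) ℝ}
    (hT : isO2 n T) (hwp : wp n ᵥ* T = wp n) :
    isO1 n (T.submatrix (fun i => i.succ.succ) (fun i => i.succ.succ)) := by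
  intro X Y
  let ext : (Fin (n + 1) → ℝ) → Fin (n + 3) → ℝ :=
    fun Z => Fin.cons (α := fun _ => ℝ) 0 (Fin.cons (α := fun _ => ℝ) 0 Z)
  have hsub : ∀ Z : Fin (n + 1) → ℝ, (fun j : Fin (n + 1) => (ext Z ᵥ* T) j.succ.succ)
      = Z ᵥ* T.submatrix (fun i => i.succ.succ) (fun i => i.succ.succ) := by
    intro Z
    funext j
    simp [ext, vecMul, dotProduct, Fin.sum_univ_succ (n := n + 2),
      Fin.sum_univ_succ (n := n + 1)]
  have hone : ∀ Z : Fin (n + 1) → ℝ, (ext Z) 1 = 0 := fun Z => rfl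
  have hsum : ∀ Z : Fin (n + 1) → ℝ, (ext Z ᵥ* T) 1 = -(ext Z ᵥ* T) 0 := by
    intro Z
    have h := hT.vecMul_zero_add_one hwp (ext Z)
    rw [hone, show ext Z 0 = 0 from rfl] at h
    linarith
  have h := hT (ext X) (ext Y)
  rw [form2_eq, form2_eq, hsub, hsub, hsum, hsum, hone, hone,
    show (fun i : Fin (n + 1) => ext X i.succ.succ) = X from rfl,
    show (fun i : Fin (n + 1) => ext Y i.succ.succ) = Y from rfl] at h
  linarith [show ext X 0 * ext Y 0 = 0 from zero_mul _]

/-- any `T ∈ O(n+1,2)` with `℘T = ℘` has the normal block form `bigT`,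
with `[[A,u],[v,w]] ∈ O(n,1)`. -/
theorem stmt0 (n : ℕ) (hn : 1 ≤ n) (T : Matrix (Fin (n + 3)) (Fin (n + 3)) ℝ)
    (hT : isO2 n T) (hwp : (wp n) ᵥ* T = wp n) :
    ∃ (a : Fin n → ℝ) (ρ w : ℝ) (A : Matrix (Fin n) (Fin n) ℝ) (u v : Fin n → ℝ),
      isO1 n (blk n A u v w) ∧ T = bigT n A u v w a ρ := by
  have hsum : ∀ i, T i 0 + T i 1 = (Pi.single i 1 : Fin (n + 3) → ℝ) 0
      + (Pi.single i 1 : Fin (n + 3) → ℝ) 1 := by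
    intro i
    have h := hT.vecMul_zero_add_one hwp (Pi.single i 1)
    rwa [single_one_vecMul] at h
  have hform : ∀ i, form2 n (T i) (T 0) = -(Pi.single i 1 : Fin (n + 3) → ℝ) 0 := by
    intro i
    have h := hT (Pi.single i 1) (Pi.single 0 1)
    rw [single_one_vecMul, single_one_vecMul] at h
    refine h.trans ?_
    simp [form2_eq, form1_eq, dotProduct]
  have hrow : T 1 = T 0 - wp n := by
    rw [← hwp, wp_vecMul]
    abel
  have h01 : T 0 1 = 1 - T 0 0 := by
    have h := hsum 0
    simp at h
    linarith
  have h00 : T 0 0 = 1 + ((fun k : Fin n => T 0 k.castSucc.succ.succ) ⬝ᵥ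
      (fun k : Fin n => T 0 k.castSucc.succ.succ)) / 2 - T 0 (Fin.last n).succ.succ ^ 2 / 2 := by
    have h := hform 0
    rw [form2_eq, form1_eq, h01, Pi.single_eq_same] at h
    linarith
  have hcol1 : ∀ i : Fin (n + 1), T i.succ.succ 1 = -T i.succ.succ 0 := by
    intro i
    have h := hsum i.succ.succ
    rw [Pi.single_eq_of_ne (Fin.succ_ne_zero _).symm,
      Pi.single_eq_of_ne (Fin.succ_succ_ne_one _).symm] at h
    linarith
  have hcol0 : ∀ i : Fin (n + 1), T i.succ.succ 0 =
      (fun k : Fin n => T i.succ.succ k.castSucc.succ.succ) ⬝ᵥ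
        (fun k : Fin n => T 0 k.castSucc.succ.succ)
        - T 0 (Fin.last n).succ.succ * T i.succ.succ (Fin.last n).succ.succ := by
    intro i
    have h := hform i.succ.succ
    rw [form2_eq, form1_eq, hcol1, h01, Pi.single_eq_of_ne (Fin.succ_ne_zero _).symm] at h
    linarith
  refine ⟨fun k => T 0 k.castSucc.succ.succ, T 0 (Fin.last n).succ.succ,
    T (Fin.last n).succ.succ (Fin.last n).succ.succ,
    fun i j => T i.castSucc.succ.succ j.castSucc.succ.succ,
    fun i => T i.castSucc.succ.succ (Fin.last n).succ.succ,
    fun j => T (Fin.last n).succ.succ j.castSucc.succ.succ, ?_, ?_⟩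
  · have h := hT.isO1_submatrix hwp
    rwa [← blk_submatrix n (T.submatrix _ _)] at h
  · funext i
    refine forall_fin_add_three (P := fun i => T i = bigT n _ _ _ _ _ _ i) ?_ ?_ ?_ ?_ i
    · refine Eq.trans ?_ (bigT_zero ..).symm
      refine (eq_emb_iff ..).2 ⟨h00, ?_, fun k => rfl, rfl⟩
      rw [h01, h00]
      ring
    · refine hrow.trans (Eq.trans ?_ (bigT_one ..).symm)
      refine (eq_emb_iff ..).2 ⟨?_, ?_, fun k => ?_, ?_⟩
      · simp only [Pi.sub_apply, wp, emb_zero]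
        rw [h00]
        ring
      · simp only [Pi.sub_apply, wp, emb_one]
        rw [h01, h00]
        ring
      · simp [wp]
      · simp [wp, -Fin.succ_last]
    · intro k
      refine Eq.trans ?_ (bigT_mid ..).symm
      refine (eq_emb_iff ..).2 ⟨hcol0 _, ?_, fun k => rfl, rfl⟩
      rw [hcol1, hcol0]
      simp [mulVec]
      ring
    · refine Eq.trans ?_ (bigT_last ..).symm
      refine (eq_emb_iff ..).2 ⟨hcol0 _, ?_, fun k => rfl, rfl⟩
      rw [hcol1, hcol0]
      ring
end
end

section
/- Let n ≥ 2 and t ∈ ℝ. For (x,ξ) ∈ Uℝⁿ write x = (x₀,x₁) ∈ ℝ^{n−1}×ℝ and ξ = (ξ₀,ξ₁) ∈ ℝ^{n−1}×ℝ. Then sinh(t)ξ₁ + cosh(t) > 0, the point ψ_t(x,ξ) = (x(t), ξ(t)) with x(t) = (x₀ − (sinh(t)x₁)/(sinh(t)ξ₁+cosh(t)) · ξ₀, x₁/(sinh(t)ξ₁+cosh(t))) and ξ(t) = (ξ₀/(sinh(t)ξ₁+cosh(t)), (cosh(t)ξ₁+sinh(t))/(sinh(t)ξ₁+cosh(t)))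 again lies in Uℝⁿ (i.e. |ξ(t)| = 1), and the flow property ψ_s(ψ_t(x,ξ)) = ψ_{s+t}(x,ξ) holds for all s, t ∈ ℝ. -/
noncomputable section

/-- The hyperbolic transformation `ψ_t` on `Uℝⁿ`, acting on points written as
`(x₀, x₁, ξ₀, ξ₁) ∈ ℝ^{n-1} × ℝ × ℝ^{n-1} × ℝ`. -/
def psiFlow (m : ℕ) (t : ℝ) (p : (Fin m → ℝ) × ℝ × (Fin m → ℝ) × ℝ) :
    (Fin m → ℝ) × ℝ × (Fin m → ℝ) × ℝ :=
  let d := Real.sinh t * p.2.2.2 + Real.cosh t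
  (p.1 - (Real.sinh t * p.2.1 / d) • p.2.2.1,
   p.2.1 / d,
   (1 / d) • p.2.2.1,
   (Real.cosh t * p.2.2.2 + Real.sinh t) / d)

theorem sinh_mul_add_cosh_pos {a : ℝ} (ha : a ^ 2 ≤ 1) (t : ℝ) :
    0 < Real.sinh t * a + Real.cosh t := by
  obtain ⟨h₁, h₂⟩ := abs_le.mp (abs_le_one_iff_mul_self_le_one.mpr (by nlinarith : a * a ≤ 1))
  rw [Real.sinh_eq, Real.cosh_eq]
  rcases lt_or_ge a 0 with h | h
  · nlinarith [Real.exp_pos t, Real.exp_pos (-t)]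
  · nlinarith [Real.exp_pos t, Real.exp_pos (-t)]

/-- The denominators appearing in `ψ_s ∘ ψ_t` multiply to that of `ψ_{s+t}`. -/
theorem sinh_mul_div_add_cosh {a t : ℝ} (h : Real.sinh t * a + Real.cosh t ≠ 0) (s : ℝ) :
    Real.sinh s * ((Real.cosh t * a + Real.sinh t) / (Real.sinh t * a + Real.cosh t))
        + Real.cosh s
      = (Real.sinh (s + t) * a + Real.cosh (s + t)) / (Real.sinh t * a + Real.cosh t) := by
  rw [Real.sinh_add, Real.cosh_add, eq_div_iff h, add_mul, mul_assoc, div_mul_cancel₀ _ h]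
  ring

/-- for `(x,ξ) ∈ Uℝⁿ` (so `|ξ|² = |ξ₀|² + ξ₁² = 1`) the denominator
`sinh t · ξ₁ + cosh t` is positive, `ψ_t(x,ξ)` again lies in `Uℝⁿ`, and
`ψ_s(ψ_t(x,ξ)) = ψ_{s+t}(x,ξ)` for all `s, t`. -/
theorem stmt6 (n : ℕ) (hn : 2 ≤ n) (t : ℝ)
    (x₀ : Fin (n - 1) → ℝ) (x₁ : ℝ) (ξ₀ : Fin (n - 1) → ℝ) (ξ₁ : ℝ)
    (hξ : (∑ i, ξ₀ i ^ 2) + ξ₁ ^ 2 = 1) :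
    0 < Real.sinh t * ξ₁ + Real.cosh t ∧
    ((∑ i, ((psiFlow (n - 1) t (x₀, x₁, ξ₀, ξ₁)).2.2.1 i) ^ 2)
        + ((psiFlow (n - 1) t (x₀, x₁, ξ₀, ξ₁)).2.2.2) ^ 2 = 1) ∧
    (∀ s : ℝ, psiFlow (n - 1) s (psiFlow (n - 1) t (x₀, x₁, ξ₀, ξ₁))
        = psiFlow (n - 1) (s + t) (x₀, x₁, ξ₀, ξ₁)) := by
  have hle : ξ₁ ^ 2 ≤ 1 := by
    have := Finset.sum_nonneg fun i (_ : i ∈ Finset.univ) => sq_nonneg (ξ₀ i)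
    linarith
  have hd := sinh_mul_add_cosh_pos hle t
  refine ⟨hd, ?_, fun s => ?_⟩
  · simp only [psiFlow, Pi.smul_apply, smul_eq_mul, mul_pow, ← Finset.mul_sum]
    rw [eq_sub_of_add_eq hξ]
    field_simp
    linear_combination (1 - ξ₁ ^ 2) * (Real.cosh_sq t).symm
  · have hD := sinh_mul_add_cosh_pos hle (s + t)
    simp only [psiFlow, sinh_mul_div_add_cosh hd.ne']
    have hsum : Real.sinh t * (Real.sinh (s + t) * ξ₁ + Real.cosh (s + t)) + Real.sinh s
        = Real.sinh (s + t) * (Real.sinh t * ξ₁ + Real.cosh t) := by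
      rw [Real.sinh_add, Real.cosh_add]
      linear_combination (-Real.sinh s) * Real.cosh_sq t
    have hnum : Real.cosh s * (Real.cosh t * ξ₁ + Real.sinh t)
        + Real.sinh s * (Real.sinh t * ξ₁ + Real.cosh t)
        = Real.cosh (s + t) * ξ₁ + Real.sinh (s + t) := by
      rw [Real.sinh_add, Real.cosh_add]
      ring
    generalize Real.sinh t * ξ₁ + Real.cosh t = d at *
    generalize Real.sinh (s + t) * ξ₁ + Real.cosh (s + t) = D at *
    refine Prod.ext (funext fun i => ?_) (Prod.ext ?_ (Prod.ext (funext fun i => ?_) ?_))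
    · simp only [Pi.sub_apply, Pi.smul_apply, smul_eq_mul]
      field_simp
      linear_combination (-x₁ * ξ₀ i) * hsum
    · simp only
      field_simp
    · simp only [Pi.smul_apply, smul_eq_mul]
      field_simp
    · simp only
      rw [← hnum]
      field_simp
end
end

section
/- Let n ≥ 2 and (x,ξ) ∈ Uℝⁿ, and set γ₁ = (½(1+|x|²), ½(1−|x|²), x, 0) and γ₂ = (x·ξ, −x·ξ, ξ, 1) in ℝ^{n+3}. Then: (a) for all p ∈ ℝⁿ, r ∈ ℝ, the point (x,ξ) lies in S(p,r) if and only if γ(p,r) lies in the 2-dimensional linear span of γ₁ and γ₂ (in which case γ(p,r) = γ₁ − rγ₂ and p = x − rξ); (b) for every unit vector η ∈ ℝⁿ and λ ∈ ℝ, the point (x,ξ) lies in P(η,λ) if and only if γ(η,λ) = (λ,−λ,η,1) lies in the linear span of γ₁ and γ₂ (in which case η = ξ, λ = x·ξ and γ(η,λ) = γ₂). -/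
open Matrix

noncomputable section

/-- The sphere coordinate `γ(p,r) = (½(1+|p|²-r²), ½(1-|p|²+r²), p, -r)`. -/
def gammaS (n : ℕ) (p : Fin n → ℝ) (r : ℝ) : Fin (n + 3) → ℝ :=
  emb n ((1 + p ⬝ᵥ p - r ^ 2) / 2) ((1 - p ⬝ᵥ p + r ^ 2) / 2) p (-r)

/-- The plane coordinate `γ(ξ,λ) = (λ, -λ, ξ, 1)`. -/
def gammaP (n : ℕ) (ξ : Fin n → ℝ) (lam : ℝ) : Fin (n + 3) → ℝ :=
  emb n lam (-lam) ξ 1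

/-- `γ₁ = (½(1+|x|²), ½(1-|x|²), x, 0)`, the point-sphere coordinate of `(x,ξ)`. -/
def gamma1 (n : ℕ) (x : Fin n → ℝ) : Fin (n + 3) → ℝ :=
  emb n ((1 + x ⬝ᵥ x) / 2) ((1 - x ⬝ᵥ x) / 2) x 0

/-- `γ₂ = (x·ξ, -x·ξ, ξ, 1)`, the tangent-plane coordinate of `(x,ξ)`. -/
def gamma2 (n : ℕ) (x ξ : Fin n → ℝ) : Fin (n + 3) → ℝ :=
  emb n (x ⬝ᵥ ξ) (-(x ⬝ᵥ ξ)) ξ 1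

theorem emb_inj {n : ℕ} {a b c a' b' c' : ℝ} {u v : Fin n → ℝ} :
    emb n a b u c = emb n a' b' v c' ↔ a = a' ∧ b = b' ∧ u = v ∧ c = c' := by
  refine ⟨fun h => ⟨?_, ?_, ?_, ?_⟩, ?_⟩
  · simpa [emb] using congrFun h ⟨0, by omega⟩
  · simpa [emb] using congrFun h ⟨1, by omega⟩
  · funext i
    have hi : i.val ≠ n := i.isLt.ne
    simpa [emb, hi] using congrFun h ⟨i.val + 2, by omega⟩
  · simpa [emb] using congrFun h ⟨n + 2, by omega⟩
  · rintro ⟨rfl, rfl, rfl, rfl⟩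
    rfl

theorem smul_emb_add_smul_emb (n : ℕ) (s t a b c a' b' c' : ℝ) (u v : Fin n → ℝ) :
    s • emb n a b u c + t • emb n a' b' v c' =
      emb n (s * a + t * a') (s * b + t * b') (s • u + t • v) (s * c + t * c') := by
  funext j
  simp only [emb, Pi.add_apply, Pi.smul_apply, smul_eq_mul]
  split_ifs <;> rfl

theorem smul_gamma1_add_smul_gamma2 (n : ℕ) (x ξ : Fin n → ℝ) (s t : ℝ) :
    s • gamma1 n x + t • gamma2 n x ξ =
      emb n (s * ((1 + x ⬝ᵥ x) / 2) + t * (x ⬝ᵥ ξ)) (s * ((1 - x ⬝ᵥ x) / 2) + t * -(x ⬝ᵥ ξ))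
        (s • x + t • ξ) (s * 0 + t * 1) :=
  smul_emb_add_smul_emb ..

theorem gammaS_sub_smul {n : ℕ} (x : Fin n → ℝ) {ξ : Fin n → ℝ} (hξ : ξ ⬝ᵥ ξ = 1) (r : ℝ) :
    gammaS n (x - r • ξ) r = gamma1 n x - r • gamma2 n x ξ := by
  have h : (x - r • ξ) ⬝ᵥ (x - r • ξ) = x ⬝ᵥ x - 2 * r * (x ⬝ᵥ ξ) + r ^ 2 := by
    simp only [sub_dotProduct, dotProduct_sub, smul_dotProduct, dotProduct_smul, smul_eq_mul,
      hξ, dotProduct_comm ξ x]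
    ring
  have h' := smul_gamma1_add_smul_gamma2 n x ξ 1 (-r)
  rw [one_smul, neg_smul, ← sub_eq_add_neg] at h'
  rw [h', gammaS, emb_inj, h]
  refine ⟨by ring, by ring, ?_, by ring⟩
  rw [one_smul, neg_smul, sub_eq_add_neg]

/-- for `(x,ξ) ∈ Uℝⁿ`:
(a) `(x,ξ) ∈ S(p,r)` iff `γ(p,r) ∈ span{γ₁,γ₂}`, in which case `γ(p,r) = γ₁ - r·γ₂`
and `p = x - rξ`;
(b) `(x,ξ) ∈ P(η,λ)` iff `γ(η,λ) ∈ span{γ₁,γ₂}`, in which case `η = ξ`, `λ = x·ξ`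
and `γ(η,λ) = γ₂`. -/
theorem stmt11 (n : ℕ) (hn : 2 ≤ n) (x ξ : Fin n → ℝ) (hξ : (∑ i, ξ i ^ 2) = 1) :
    (∀ (p : Fin n → ℝ) (r : ℝ),
      (x - p = r • ξ ↔
        gammaS n p r ∈ Submodule.span ℝ {gamma1 n x, gamma2 n x ξ}) ∧
      (x - p = r • ξ →
        gammaS n p r = gamma1 n x - r • gamma2 n x ξ ∧ p = x - r • ξ)) ∧
    (∀ (η : Fin n → ℝ) (lam : ℝ), (∑ i, η i ^ 2) = 1 →
      ((ξ = η ∧ x ⬝ᵥ η = lam) ↔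
        gammaP n η lam ∈ Submodule.span ℝ {gamma1 n x, gamma2 n x ξ}) ∧
      ((ξ = η ∧ x ⬝ᵥ η = lam) →
        η = ξ ∧ lam = x ⬝ᵥ ξ ∧ gammaP n η lam = gamma2 n x ξ)) := by
  have hξ' : ξ ⬝ᵥ ξ = 1 := by simpa only [dotProduct, pow_two] using hξ
  have contact (p : Fin n → ℝ) (r : ℝ) (h : x - p = r • ξ) : p = x - r • ξ := by
    rw [← h, sub_sub_cancel]
  refine ⟨fun p r => ⟨⟨fun h => ?_, fun h => ?_⟩, fun h => ?_⟩,
    fun η lam _ => ⟨⟨?_, fun h => ?_⟩, ?_⟩⟩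
  · rw [contact p r h, gammaS_sub_smul x hξ' r, Submodule.mem_span_pair]
    exact ⟨1, -r, by rw [one_smul, neg_smul, sub_eq_add_neg]⟩
  · obtain ⟨s, t, hst⟩ := Submodule.mem_span_pair.1 h
    rw [smul_gamma1_add_smul_gamma2, gammaS, emb_inj] at hst
    obtain ⟨h₀, h₁, hp, hr⟩ := hst
    obtain rfl : s = 1 := by linarith
    obtain rfl : t = -r := by linarith
    rw [← hp, one_smul, neg_smul, ← sub_eq_add_neg, sub_sub_cancel]
  · have hp := contact p r h
    exact ⟨by rw [hp, gammaS_sub_smul x hξ' r], hp⟩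
  · rintro ⟨rfl, rfl⟩
    exact Submodule.subset_span (by simp [gammaP, gamma2])
  · obtain ⟨s, t, hst⟩ := Submodule.mem_span_pair.1 h
    rw [smul_gamma1_add_smul_gamma2, gammaP, emb_inj] at hst
    obtain ⟨h₀, h₁, hη, ht⟩ := hst
    obtain rfl : s = 0 := by linarith
    obtain rfl : t = 1 := by linarith
    rw [zero_smul, one_smul, zero_add] at hη
    subst hη
    exact ⟨rfl, by linarith⟩
  · rintro ⟨rfl, rfl⟩
    exact ⟨rfl, rfl, rfl⟩
end
end

section
/- Let n ≥ 1 and let T ∈ O(n+1,2) satisfy ℘T = ℘. Then: (a) for every (p,r) ∈ ℝⁿ × ℝ there is a unique (p̃,r̃) ∈ ℝⁿ × ℝ with γ(p,r)·T = γ(p̃,r̃); (b) writing (p̃,r̃) = Φ_T(p,r) and (p̃*,r̃*) = Φ_T(p*,r*) for two pairs of spheres, the tangential-distance quantity is preserved: |p̃* − p̃|² − (r̃* − r̃)² = |p* − p|² − (r* − r)². In other words, the Laguerre transformation T maps sphere coordinates to sphere coordinates and leaves the invariant F = |p*−p|² − (r*−r)² unchanged. -/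
open Matrix

noncomputable section

theorem emb_zero_s13 {n : ℕ} (a b : ℝ) (m : Fin n → ℝ) (l : ℝ) : emb n a b m l 0 = a := by
  simp [emb]

theorem emb_one_s13 {n : ℕ} (a b : ℝ) (m : Fin n → ℝ) (l : ℝ) :
    emb n a b m l (Fin.succ 0) = b := by
  simp [emb]

theorem emb_mid_s13 {n : ℕ} (a b : ℝ) (m : Fin n → ℝ) (l : ℝ) (i : Fin n) :
    emb n a b m l i.castSucc.succ.succ = m i := by
  have := i.isLt
  simp [emb, this.ne]

theorem emb_last_s13 {n : ℕ} (a b : ℝ) (m : Fin n → ℝ) (l : ℝ) :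
    emb n a b m l (Fin.last n).succ.succ = l := by
  simp [emb]

/-- Every vector of `ℝ^{n+3}` is given by its coordinates. -/
theorem exists_eq_emb {n : ℕ} (X : Fin (n + 3) → ℝ) : ∃ a b m l, X = emb n a b m l := by
  refine ⟨X 0, X (Fin.succ 0), fun i => X i.castSucc.succ.succ, X (Fin.last n).succ.succ, ?_⟩
  funext j
  refine Fin.cases (emb_zero_s13 _ _ _ _).symm (fun j => ?_) j
  refine Fin.cases (emb_one_s13 _ _ _ _).symm (fun j => ?_) j
  exact Fin.lastCases (emb_last_s13 _ _ _ _).symm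
    (fun j => (emb_mid_s13 _ _ (fun i => X i.castSucc.succ.succ) _ j).symm) j

theorem form2_emb {n : ℕ} (a b : ℝ) (m : Fin n → ℝ) (l a' b' : ℝ) (m' : Fin n → ℝ) (l' : ℝ) :
    form2 n (emb n a b m l) (emb n a' b' m' l') = -(a * a') + b * b' + m ⬝ᵥ m' - l * l' := by
  have h (i : Fin n) : (i : ℕ) ≠ n := i.isLt.ne
  rw [form2, Fin.sum_univ_succ, Fin.sum_univ_succ, Fin.sum_univ_castSucc]
  simp only [emb_zero_s13, emb_one_s13, emb_mid_s13, emb_last_s13]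
  simp [h, dotProduct]
  ring

theorem form2_gammaS_wp {n : ℕ} (p : Fin n → ℝ) (r : ℝ) : form2 n (gammaS n p r) (wp n) = -1 := by
  rw [gammaS, wp, form2_emb, dotProduct_zero]
  ring

/-- The form on two sphere coordinates is `-F / 2`, with `F` the squared tangential distance. -/
theorem form2_gammaS {n : ℕ} (p p' : Fin n → ℝ) (r r' : ℝ) :
    form2 n (gammaS n p r) (gammaS n p' r')
      = -((∑ i, (p' i - p i) ^ 2) - (r' - r) ^ 2) / 2 := by
  have h : ∑ i, (p' i - p i) ^ 2 = p' ⬝ᵥ p' - 2 * (p ⬝ᵥ p') + p ⬝ᵥ p := by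
    simp only [dotProduct, Finset.mul_sum, ← Finset.sum_sub_distrib, ← Finset.sum_add_distrib]
    exact Finset.sum_congr rfl fun i _ => by ring
  rw [gammaS, gammaS, form2_emb, h]
  ring

/-- Sphere coordinates are the null vectors `X` with `⟨X, ℘⟩ = -1`. -/
theorem exists_eq_gammaS {n : ℕ} {X : Fin (n + 3) → ℝ} (hX : form2 n X X = 0)
    (hXwp : form2 n X (wp n) = -1) : ∃ p r, X = gammaS n p r := by
  obtain ⟨a, b, m, l, rfl⟩ := exists_eq_emb X
  rw [form2_emb] at hX
  rw [wp, form2_emb, dotProduct_zero] at hXwp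
  obtain rfl : a = 1 - b := by linarith
  refine ⟨m, -l, ?_⟩
  rw [gammaS, neg_neg]
  congr 1 <;> linarith

theorem gammaS_inj {n : ℕ} {p p' : Fin n → ℝ} {r r' : ℝ} (h : gammaS n p r = gammaS n p' r') :
    p = p' ∧ r = r' := by
  constructor
  · funext i
    simpa only [gammaS, emb_mid_s13] using congrFun h i.castSucc.succ.succ
  · have := congrFun h (Fin.last n).succ.succ
    simp only [gammaS, emb_last_s13] at this
    exact neg_injective this

/-- a Laguerre transformation `T` maps sphere coordinates to sphere
coordinates (with uniquely determined image data), and preserves the tangential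
distance invariant `F = |p*-p|² - (r*-r)²`. -/
theorem stmt13 (n : ℕ) (hn : 1 ≤ n) (T : Matrix (Fin (n + 3)) (Fin (n + 3)) ℝ)
    (hT : isO2 n T) (hwp : (wp n) ᵥ* T = wp n) :
    (∀ (p : Fin n → ℝ) (r : ℝ),
      ∃! qr : (Fin n → ℝ) × ℝ, (gammaS n p r) ᵥ* T = gammaS n qr.1 qr.2) ∧
    (∀ (p p' pt pt' : Fin n → ℝ) (r r' rt rt' : ℝ),
      (gammaS n p r) ᵥ* T = gammaS n pt rt →
      (gammaS n p' r') ᵥ* T = gammaS n pt' rt' →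
      (∑ i, (pt' i - pt i) ^ 2) - (rt' - rt) ^ 2
        = (∑ i, (p' i - p i) ^ 2) - (r' - r) ^ 2) := by
  refine ⟨fun p r => ?_, fun p p' pt pt' r r' rt rt' h h' => ?_⟩
  · obtain ⟨q, s, hqs⟩ := exists_eq_gammaS (X := gammaS n p r ᵥ* T)
      (by rw [hT, form2_gammaS]; simp)
      (by
        conv_lhs => rw [← hwp]
        rw [hT, form2_gammaS_wp])
    refine ⟨(q, s), hqs, fun y hy => ?_⟩
    obtain ⟨h₁, h₂⟩ := gammaS_inj (hy.symm.trans hqs)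
    exact Prod.ext h₁ h₂
  · have key := hT (gammaS n p r) (gammaS n p' r')
    rw [h, h', form2_gammaS, form2_gammaS] at key
    linarith
end
end

section
/- Let n ≥ 1. Every T ∈ L𝔾 can be written uniquely in the normal form determined by parameters (A, u, v, w, a, ρ) with [[A,u],[v,w]] ∈ O(n,1), a ∈ ℝⁿ, ρ ∈ ℝ (rows of T: (1+|a|²/2−ρ²/2, −|a|²/2+ρ²/2, a, ρ); (|a|²/2−ρ²/2, 1−|a|²/2+ρ²/2, a, ρ); (Aaᵀ−ρu, −Aaᵀ+ρu, A, u); (vaᵀ−ρw, −vaᵀ+ρw, v, w)), and the map Φ sending such T to the (n+2)×(n+2) matrix with block rows (A, u, 0), (v, w, 0), (a, ρ, 1) is a group isomorphism from L𝔾 onto the group of all (n+2)×(n+2) real matrices of this form with [[A,u],[v,w]] ∈ O(n,1); in particular Φ(T₁T₂) = Φ(T₁)Φ(T₂) for all T₁, T₂ ∈ L𝔾. -/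
open Matrix

noncomputable section

/-- Parameters `(A, u, v, w, a, ρ)` of the normal form of a Laguerre transformation. -/
def LParams (n : ℕ) : Type :=
  Matrix (Fin n) (Fin n) ℝ × (Fin n → ℝ) × (Fin n → ℝ) × ℝ × (Fin n → ℝ) × ℝ

/-- The big matrix `T` determined by parameters `(A,u,v,w,a,ρ)`. -/
def bigT' (n : ℕ) (q : LParams n) : Matrix (Fin (n + 3)) (Fin (n + 3)) ℝ :=
  bigT n q.1 q.2.1 q.2.2.1 q.2.2.2.1 q.2.2.2.2.1 q.2.2.2.2.2

/-- The block matrix `[[A,u],[v,w]]` of the parameters. -/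
def blk' (n : ℕ) (q : LParams n) : Matrix (Fin (n + 1)) (Fin (n + 1)) ℝ :=
  blk n q.1 q.2.1 q.2.2.1 q.2.2.2.1

/-- The `(n+2)×(n+2)` matrix `Φ(T)` with block rows `(A, u, 0)`, `(v, w, 0)`, `(a, ρ, 1)`. -/
def smallM (n : ℕ) (q : LParams n) : Matrix (Fin (n + 2)) (Fin (n + 2)) ℝ :=
  Matrix.of fun i j =>
    if hi : i.val < n then
      (if hj : j.val < n then q.1 ⟨i.val, hi⟩ ⟨j.val, hj⟩
       else if j.val = n then q.2.1 ⟨i.val, hi⟩ else 0)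
    else if i.val = n then
      (if hj : j.val < n then q.2.2.1 ⟨j.val, hj⟩
       else if j.val = n then q.2.2.2.1 else 0)
    else
      (if hj : j.val < n then q.2.2.2.2.1 ⟨j.val, hj⟩
       else if j.val = n then q.2.2.2.2.2 else 1)

/-- The row vector `(x0, x1, x)` in `ℝ^{n+3}` with `x ∈ ℝ^{n+1}`. -/
def consTwo {n : ℕ} (x0 x1 : ℝ) (x : Fin (n + 1) → ℝ) : Fin (n + 3) → ℝ :=
  vecCons x0 (vecCons x1 x)

@[simp] lemma consTwo_zero {n : ℕ} (x0 x1 : ℝ) (x : Fin (n + 1) → ℝ) :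
    consTwo x0 x1 x 0 = x0 := rfl

@[simp] lemma consTwo_one {n : ℕ} (x0 x1 : ℝ) (x : Fin (n + 1) → ℝ) :
    consTwo x0 x1 x 1 = x1 := rfl

@[simp] lemma consTwo_succ_succ {n : ℕ} (x0 x1 : ℝ) (x : Fin (n + 1) → ℝ) (i : Fin (n + 1)) :
    consTwo x0 x1 x i.succ.succ = x i := rfl

lemma forall_fin_add_three_s14 {n : ℕ} {p : Fin (n + 3) → Prop} :
    (∀ i, p i) ↔ p 0 ∧ p 1 ∧ ∀ i : Fin (n + 1), p i.succ.succ := by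
  rw [Fin.forall_fin_succ, Fin.forall_fin_succ]
  rfl

lemma consTwo_eta {n : ℕ} (X : Fin (n + 3) → ℝ) :
    consTwo (X 0) (X 1) (fun i => X i.succ.succ) = X := by
  refine funext (forall_fin_add_three_s14.2 ⟨rfl, rfl, fun i => rfl⟩)

lemma emb_eq_consTwo (n : ℕ) (c0 c1 : ℝ) (y : Fin n → ℝ) (d : ℝ) :
    emb n c0 c1 y d = consTwo c0 c1 (Fin.snoc y d) := by
  refine funext (forall_fin_add_three_s14.2 ⟨rfl, rfl, fun i => ?_⟩)
  refine Fin.lastCases ?_ (fun i => ?_) i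
  · rw [consTwo_succ_succ, Fin.snoc_last]
    simp [emb]
  · have := i.isLt
    simp [emb, this.ne]

lemma wp_eq_consTwo (n : ℕ) : wp n = consTwo 1 (-1) 0 := by
  rw [wp, emb_eq_consTwo]
  congr 1
  ext i
  refine Fin.lastCases ?_ (fun i => ?_) i <;> simp

/-- The vector `η y` such that `form1 n x y = x ⬝ᵥ η y`. -/
def lower (n : ℕ) (y : Fin (n + 1) → ℝ) : Fin (n + 1) → ℝ :=
  fun i => (if i.val = n then (-1 : ℝ) else 1) * y i

lemma form1_eq_dotProduct (n : ℕ) (x y : Fin (n + 1) → ℝ) :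
    form1 n x y = x ⬝ᵥ lower n y := by
  simp only [form1, dotProduct, lower]
  exact Finset.sum_congr rfl fun i _ => by ring

lemma form1_comm (n : ℕ) (x y : Fin (n + 1) → ℝ) : form1 n x y = form1 n y x :=
  Finset.sum_congr rfl fun i _ => by ring

lemma form1_add_smul_left (n : ℕ) (t : ℝ) (x y z : Fin (n + 1) → ℝ) :
    form1 n (t • x + y) z = t * form1 n x z + form1 n y z := by
  simp [form1_eq_dotProduct]

lemma form1_add_smul_right (n : ℕ) (t : ℝ) (x y z : Fin (n + 1) → ℝ) :
    form1 n z (t • x + y) = t * form1 n z x + form1 n z y := by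
  simp only [form1_comm n z, form1_add_smul_left]

@[simp] lemma form1_zero_left (n : ℕ) (x : Fin (n + 1) → ℝ) : form1 n 0 x = 0 := by
  simp [form1]

@[simp] lemma form1_zero_right (n : ℕ) (x : Fin (n + 1) → ℝ) : form1 n x 0 = 0 := by
  simp [form1]

lemma dotProduct_form1_rows (n : ℕ) (S : Matrix (Fin (n + 1)) (Fin (n + 1)) ℝ)
    (x b : Fin (n + 1) → ℝ) :
    (x ⬝ᵥ fun i => form1 n (S i) b) = form1 n (x ᵥ* S) b := by
  simp only [form1_eq_dotProduct]
  exact dotProduct_mulVec x S (lower n b)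

lemma form1_snoc (n : ℕ) (x y : Fin n → ℝ) (s t : ℝ) :
    form1 n (Fin.snoc x s : Fin (n + 1) → ℝ) (Fin.snoc y t : Fin (n + 1) → ℝ)
      = x ⬝ᵥ y - s * t := by
  have h (i : Fin n) : i.val ≠ n := i.isLt.ne
  simp [form1, Fin.sum_univ_castSucc, dotProduct, h, sub_eq_add_neg]

lemma form2_consTwo (n : ℕ) (x0 x1 y0 y1 : ℝ) (x y : Fin (n + 1) → ℝ) :
    form2 n (consTwo x0 x1 x) (consTwo y0 y1 y) = -(x0 * y0) + x1 * y1 + form1 n x y := by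
  rw [form2, Fin.sum_univ_succ, Fin.sum_univ_succ, form1]
  have h1 : (Fin.succ 0 : Fin (n + 3)) = 1 := rfl
  simp [h1, add_assoc]

/-- The normal form of a Laguerre transformation in terms of `S ∈ O(n,1)` and `b ∈ ℝ^{n+1}`. -/
def normalForm (n : ℕ) (S : Matrix (Fin (n + 1)) (Fin (n + 1)) ℝ) (b : Fin (n + 1) → ℝ) :
    Matrix (Fin (n + 3)) (Fin (n + 3)) ℝ :=
  Matrix.of (vecCons (consTwo (1 + form1 n b b / 2) (-(form1 n b b / 2)) b)
    (vecCons (consTwo (form1 n b b / 2) (1 - form1 n b b / 2) b)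
      (fun i => consTwo (form1 n (S i) b) (-form1 n (S i) b) (S i))))

lemma normalForm_zero (n : ℕ) (S : Matrix (Fin (n + 1)) (Fin (n + 1)) ℝ)
    (b : Fin (n + 1) → ℝ) :
    normalForm n S b 0 = consTwo (1 + form1 n b b / 2) (-(form1 n b b / 2)) b := rfl

lemma normalForm_one (n : ℕ) (S : Matrix (Fin (n + 1)) (Fin (n + 1)) ℝ)
    (b : Fin (n + 1) → ℝ) :
    normalForm n S b 1 = consTwo (form1 n b b / 2) (1 - form1 n b b / 2) b := rfl

lemma normalForm_succ_succ (n : ℕ) (S : Matrix (Fin (n + 1)) (Fin (n + 1)) ℝ)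
    (b : Fin (n + 1) → ℝ) (i : Fin (n + 1)) :
    normalForm n S b i.succ.succ = consTwo (form1 n (S i) b) (-form1 n (S i) b) (S i) := rfl

lemma consTwo_vecMul_apply {n : ℕ} (T : Matrix (Fin (n + 3)) (Fin (n + 3)) ℝ) (x0 x1 : ℝ)
    (x : Fin (n + 1) → ℝ) (j : Fin (n + 3)) :
    (consTwo x0 x1 x ᵥ* T) j = x0 * T 0 j + x1 * T 1 j + x ⬝ᵥ fun i => T i.succ.succ j := by
  refine Eq.trans ?_ (add_assoc _ _ _).symm
  exact (Fin.sum_univ_succ _).trans (congrArg _ (Fin.sum_univ_succ _))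

lemma consTwo_vecMul_normalForm (n : ℕ) (S : Matrix (Fin (n + 1)) (Fin (n + 1)) ℝ)
    (b x : Fin (n + 1) → ℝ) (x0 x1 : ℝ) :
    consTwo x0 x1 x ᵥ* normalForm n S b =
      consTwo (x0 + ((x0 + x1) * (form1 n b b / 2) + form1 n (x ᵥ* S) b))
        (x1 - ((x0 + x1) * (form1 n b b / 2) + form1 n (x ᵥ* S) b))
        ((x0 + x1) • b + x ᵥ* S) := by
  refine funext (forall_fin_add_three_s14.2 ⟨?_, ?_, fun j => ?_⟩)
  · simp only [consTwo_vecMul_apply, normalForm_zero, normalForm_one, normalForm_succ_succ,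
      consTwo_zero, dotProduct_form1_rows]
    ring
  · simp only [consTwo_vecMul_apply, normalForm_zero, normalForm_one, normalForm_succ_succ,
      consTwo_one, ← dotProduct_form1_rows]
    have h : (x ⬝ᵥ fun i => -form1 n (S i) b) = -(x ⬝ᵥ fun i => form1 n (S i) b) :=
      dotProduct_neg x _
    rw [h]
    ring
  · rw [consTwo_vecMul_apply]
    simp only [normalForm_zero, normalForm_one, normalForm_succ_succ, consTwo_succ_succ, Pi.add_apply,
      Pi.smul_apply, smul_eq_mul, vecMul]
    ring

lemma isO2_normalForm (n : ℕ) {S : Matrix (Fin (n + 1)) (Fin (n + 1)) ℝ} (hS : isO1 n S)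
    (b : Fin (n + 1) → ℝ) : isO2 n (normalForm n S b) := by
  intro X Y
  rw [← consTwo_eta X, ← consTwo_eta Y]
  simp only [consTwo_vecMul_normalForm, form2_consTwo, form1_add_smul_left,
    form1_add_smul_right, hS _ _, form1_comm n b (_ ᵥ* S)]
  ring

lemma wp_vecMul_normalForm (n : ℕ) (S : Matrix (Fin (n + 1)) (Fin (n + 1)) ℝ)
    (b : Fin (n + 1) → ℝ) : wp n ᵥ* normalForm n S b = wp n := by
  simp [wp_eq_consTwo, consTwo_vecMul_normalForm]

lemma row_eq_consTwo_vecMul {n : ℕ} (T : Matrix (Fin (n + 3)) (Fin (n + 3)) ℝ) :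
    consTwo 1 0 0 ᵥ* T = T 0 ∧
      ∀ i, consTwo 0 0 (Pi.single i 1) ᵥ* T = T i.succ.succ := by
  refine ⟨funext fun j => ?_, fun i => funext fun j => ?_⟩ <;> simp [consTwo_vecMul_apply]

lemma exists_normalForm {n : ℕ} {T : Matrix (Fin (n + 3)) (Fin (n + 3)) ℝ} (hT : isO2 n T)
    (hw : wp n ᵥ* T = wp n) : ∃ S b, isO1 n S ∧ T = normalForm n S b := by
  set S : Matrix (Fin (n + 1)) (Fin (n + 1)) ℝ := Matrix.of fun i j => T i.succ.succ j.succ.succ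
  set b : Fin (n + 1) → ℝ := fun j => T 0 j.succ.succ
  obtain ⟨row0, row2⟩ := row_eq_consTwo_vecMul T
  have orth (x : Fin (n + 1) → ℝ) : ∃ c, consTwo 0 0 x ᵥ* T = consTwo c (-c) (x ᵥ* S) := by
    have h := hT (consTwo 0 0 x) (wp n)
    rw [hw, ← consTwo_eta (consTwo 0 0 x ᵥ* T), wp_eq_consTwo, form2_consTwo,
      form2_consTwo] at h
    simp only [form1_zero_right] at h
    refine ⟨(consTwo 0 0 x ᵥ* T) 0, ?_⟩
    conv_lhs => rw [← consTwo_eta (consTwo 0 0 x ᵥ* T)]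
    congr 1
    · linarith
    · ext j
      rw [consTwo_vecMul_apply]
      simp [vecMul, S]
  have hS : isO1 n S := by
    intro x y
    obtain ⟨c, hc⟩ := orth x
    obtain ⟨d, hd⟩ := orth y
    have h := hT (consTwo 0 0 x) (consTwo 0 0 y)
    rw [hc, hd, form2_consTwo, form2_consTwo] at h
    linarith
  have hT0 : T 0 = consTwo (1 + form1 n b b / 2) (-(form1 n b b / 2)) b := by
    have eta : consTwo (T 0 0) (T 0 1) b = T 0 := consTwo_eta (T 0)
    have h1 := hT (consTwo 1 0 0) (wp n)
    have h2 := hT (consTwo 1 0 0) (consTwo 1 0 0)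
    rw [hw, row0, ← eta, wp_eq_consTwo, form2_consTwo, form2_consTwo] at h1
    rw [row0, ← eta, form2_consTwo, form2_consTwo] at h2
    simp only [form1_zero_right] at h1 h2
    have h3 : T 0 1 = 1 - T 0 0 := by linarith
    rw [h3] at h2
    have h4 : T 0 0 = 1 + form1 n b b / 2 := by linarith
    rw [← eta, h3, h4]
    congr 1
    ring
  refine ⟨S, b, hS, funext (forall_fin_add_three_s14.2 ⟨hT0, ?_, fun i => ?_⟩)⟩
  · have h : T 1 = T 0 - wp n := by
      ext j
      have := congrFun hw j
      nth_rewrite 1 [wp_eq_consTwo] at this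
      simp only [consTwo_vecMul_apply, zero_dotProduct] at this
      simp only [Pi.sub_apply]
      linarith
    rw [h, hT0, wp_eq_consTwo, normalForm_one]
    refine funext (forall_fin_add_three_s14.2 ⟨?_, ?_, fun j => ?_⟩) <;> simp
    ring
  · obtain ⟨c, hc⟩ := orth (Pi.single i 1)
    have h := hT (consTwo 1 0 0) (consTwo 0 0 (Pi.single i 1))
    rw [hc, row0, hT0, form2_consTwo, form2_consTwo] at h
    have hrow : Pi.single i 1 ᵥ* S = S i := single_one_vecMul i S
    rw [hrow, form1_comm n b (S i)] at h
    simp only [form1_zero_left] at h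
    have hc' : c = form1 n (S i) b := by linarith
    rw [← row2 i, hc, hrow, hc', normalForm_succ_succ]

lemma normalForm_mul_eq (n : ℕ) {S₁ S₂ S₃ : Matrix (Fin (n + 1)) (Fin (n + 1)) ℝ}
    {b₁ b₂ b₃ : Fin (n + 1) → ℝ}
    (h : normalForm n S₁ b₁ * normalForm n S₂ b₂ = normalForm n S₃ b₃) :
    S₁ * S₂ = S₃ ∧ b₁ ᵥ* S₂ + b₂ = b₃ := by
  have hrow (i) : normalForm n S₁ b₁ i ᵥ* normalForm n S₂ b₂ = normalForm n S₃ b₃ i := by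
    rw [← h]; rfl
  constructor
  · ext i j
    change (S₁ i ᵥ* S₂) j = S₃ i j
    have := congrFun (hrow i.succ.succ) j.succ.succ
    simpa [normalForm_succ_succ, consTwo_vecMul_normalForm] using this
  · ext j
    have := congrFun (hrow 0) j.succ.succ
    simpa [normalForm_zero, consTwo_vecMul_normalForm, add_comm] using this

lemma normalForm_injective (n : ℕ) {S S' : Matrix (Fin (n + 1)) (Fin (n + 1)) ℝ}
    {b b' : Fin (n + 1) → ℝ} (h : normalForm n S b = normalForm n S' b') :
    S = S' ∧ b = b' :=
  ⟨Matrix.ext fun i j => congrFun (congrFun h i.succ.succ) j.succ.succ,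
    funext fun j => congrFun (congrFun h 0) j.succ.succ⟩

/-- The translation vector `(a, ρ)` of the parameters. -/
def transl (n : ℕ) (q : LParams n) : Fin (n + 1) → ℝ :=
  Fin.snoc q.2.2.2.2.1 q.2.2.2.2.2

lemma blk'_castSucc (n : ℕ) (q : LParams n) (i : Fin n) :
    blk' n q i.castSucc = Fin.snoc (q.1 i) (q.2.1 i) := by
  have h (i : Fin n) : i.val ≠ n := i.isLt.ne
  ext j
  refine Fin.lastCases ?_ (fun j => ?_) j <;> simp [blk', blk, h]

lemma blk'_last (n : ℕ) (q : LParams n) :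
    blk' n q (Fin.last n) = Fin.snoc q.2.2.1 q.2.2.2.1 := by
  have h (i : Fin n) : i.val ≠ n := i.isLt.ne
  ext j
  refine Fin.lastCases ?_ (fun j => ?_) j <;> simp [blk', blk, h]

lemma params_ext (n : ℕ) {q q' : LParams n} (hS : blk' n q = blk' n q')
    (hb : transl n q = transl n q') : q = q' := by
  have hrow (i : Fin n) := congrFun hS i.castSucc
  have hlast := congrFun hS (Fin.last n)
  simp only [blk'_castSucc, blk'_last, Fin.snoc_inj] at hrow hlast
  simp only [transl, Fin.snoc_inj] at hb
  exact Prod.ext (funext fun i => (hrow i).1) (Prod.ext (funext fun i => (hrow i).2)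
    (Prod.ext hlast.1 (Prod.ext hlast.2 (Prod.ext hb.1 hb.2))))

lemma exists_params (n : ℕ) (S : Matrix (Fin (n + 1)) (Fin (n + 1)) ℝ) (b : Fin (n + 1) → ℝ) :
    ∃ q : LParams n, blk' n q = S ∧ transl n q = b := by
  refine ⟨(Matrix.of fun i j => S i.castSucc j.castSucc, fun i => S i.castSucc (Fin.last n),
    fun j => S (Fin.last n) j.castSucc, S (Fin.last n) (Fin.last n),
    fun j => b j.castSucc, b (Fin.last n)), funext fun i => ?_, Fin.snoc_init_self b⟩
  refine Fin.lastCases ?_ (fun i => ?_) i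
  · exact (blk'_last n _).trans (Fin.snoc_init_self (S (Fin.last n)))
  · exact (blk'_castSucc n _ i).trans (Fin.snoc_init_self (S i.castSucc))

lemma bigT'_eq_normalForm (n : ℕ) (q : LParams n) :
    bigT' n q = normalForm n (blk' n q) (transl n q) := by
  have hb : form1 n (transl n q) (transl n q)
      = q.2.2.2.2.1 ⬝ᵥ q.2.2.2.2.1 - q.2.2.2.2.2 ^ 2 := by
    rw [transl, form1_snoc, sq]
  refine funext (forall_fin_add_three_s14.2 ⟨?_, ?_, fun i => ?_⟩)
  · rw [normalForm_zero, hb]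
    refine (emb_eq_consTwo _ _ _ _ _).trans ?_
    rw [transl]
    congr 1 <;> ring
  · rw [normalForm_one, hb]
    refine (emb_eq_consTwo _ _ _ _ _).trans ?_
    rw [transl]
    congr 1 <;> ring
  · rw [normalForm_succ_succ]
    refine Fin.lastCases ?_ (fun i => ?_) i
    · have h : bigT' n q (Fin.last n).succ.succ
          = emb n (q.2.2.1 ⬝ᵥ q.2.2.2.2.1 - q.2.2.2.2.2 * q.2.2.2.1)
            (-(q.2.2.1 ⬝ᵥ q.2.2.2.2.1) + q.2.2.2.2.2 * q.2.2.2.1) q.2.2.1 q.2.2.2.1 := by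
        ext j
        simp [bigT', bigT]
      rw [h, emb_eq_consTwo, blk'_last, transl, form1_snoc]
      congr 1 <;> ring
    · have hi : i.val ≠ n := i.isLt.ne
      have h : bigT' n q i.castSucc.succ.succ
          = emb n ((q.1 *ᵥ q.2.2.2.2.1) i - q.2.2.2.2.2 * q.2.1 i)
            (-((q.1 *ᵥ q.2.2.2.2.1) i) + q.2.2.2.2.2 * q.2.1 i) (q.1 i) (q.2.1 i) := by
        ext j
        simp [bigT', bigT, hi]
      rw [h, emb_eq_consTwo, blk'_castSucc, transl, form1_snoc, mulVec]
      congr 1 <;> ring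

lemma smallM_castSucc (n : ℕ) (q : LParams n) (i : Fin (n + 1)) :
    smallM n q i.castSucc = Fin.snoc (blk' n q i) 0 := by
  have h (i : Fin n) : i.val ≠ n := i.isLt.ne
  ext j
  refine Fin.lastCases ?_ (fun j => ?_) j <;> refine Fin.lastCases ?_ (fun i => ?_) i <;>
    try refine Fin.lastCases ?_ (fun j => ?_) j
  all_goals simp [smallM, blk', blk, h]

lemma smallM_last (n : ℕ) (q : LParams n) :
    smallM n q (Fin.last (n + 1)) = Fin.snoc (transl n q) 1 := by
  ext j
  refine Fin.lastCases ?_ (fun j => ?_) j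
  · simp [smallM]
  · refine Fin.lastCases ?_ (fun j => ?_) j <;> simp [smallM, transl]

lemma smallM_injective (n : ℕ) {q q' : LParams n} (h : smallM n q = smallM n q') : q = q' := by
  have hrow (i : Fin (n + 1)) := congrFun h i.castSucc
  have hlast := congrFun h (Fin.last (n + 1))
  simp only [smallM_castSucc, smallM_last, Fin.snoc_inj] at hrow hlast
  exact params_ext n (funext fun i => (hrow i).1) hlast.1

lemma smallM_mul (n : ℕ) {q₁ q₂ q₃ : LParams n} (hS : blk' n q₁ * blk' n q₂ = blk' n q₃)
    (hb : transl n q₁ ᵥ* blk' n q₂ + transl n q₂ = transl n q₃) :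
    smallM n q₁ * smallM n q₂ = smallM n q₃ := by
  ext i j
  rw [Matrix.mul_apply, Fin.sum_univ_castSucc]
  refine Fin.lastCases ?_ (fun i => ?_) i <;> refine Fin.lastCases ?_ (fun j => ?_) j
  all_goals simp only [smallM_castSucc, smallM_last, Fin.snoc_castSucc, Fin.snoc_last, ← hS, ← hb]
  all_goals simp [vecMul, dotProduct, Matrix.mul_apply]

/-- every `T ∈ L𝔾` has a unique normal form `bigT(A,u,v,w,a,ρ)` with
`[[A,u],[v,w]] ∈ O(n,1)`; conversely all such normal forms lie in `L𝔾`; the map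
`Φ : T ↦ smallM(A,u,v,w,a,ρ)` is injective and multiplicative, hence a group
isomorphism from `L𝔾` onto the group of `(n+2)×(n+2)` matrices of the displayed
block form with `[[A,u],[v,w]] ∈ O(n,1)`. -/
theorem stmt14 (n : ℕ) (hn : 1 ≤ n) :
    (∀ T : Matrix (Fin (n + 3)) (Fin (n + 3)) ℝ,
      isO2 n T → (wp n) ᵥ* T = wp n →
      ∃! q : LParams n, isO1 n (blk' n q) ∧ T = bigT' n q) ∧
    (∀ q : LParams n, isO1 n (blk' n q) →
      isO2 n (bigT' n q) ∧ (wp n) ᵥ* (bigT' n q) = wp n) ∧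
    (∀ q q' : LParams n, smallM n q = smallM n q' → q = q') ∧
    (∀ q₁ q₂ q₃ : LParams n,
      isO1 n (blk' n q₁) → isO1 n (blk' n q₂) → isO1 n (blk' n q₃) →
      bigT' n q₁ * bigT' n q₂ = bigT' n q₃ →
      smallM n q₁ * smallM n q₂ = smallM n q₃) := by
  refine ⟨fun T hT hw => ?_, fun q hq => ?_, fun _ _ h => smallM_injective n h,
    fun q₁ q₂ q₃ _ _ _ h => ?_⟩
  · obtain ⟨S, b, hS, rfl⟩ := exists_normalForm hT hw
    obtain ⟨q, rfl, rfl⟩ := exists_params n S b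
    refine ⟨q, ⟨hS, (bigT'_eq_normalForm n q).symm⟩, fun q' ⟨_, h⟩ => ?_⟩
    rw [bigT'_eq_normalForm] at h
    obtain ⟨h1, h2⟩ := normalForm_injective n h
    exact params_ext n h1.symm h2.symm
  · rw [bigT'_eq_normalForm]
    exact ⟨isO2_normalForm n hq _, wp_vecMul_normalForm n _ _⟩
  · simp only [bigT'_eq_normalForm] at h
    obtain ⟨hS, hb⟩ := normalForm_mul_eq n h
    exact smallM_mul n hS hb
end
end

section
/- Let n ≥ 2. For (x,ξ) ∈ Uℝⁿ₁ write x = (x₀,x₁) ∈ ℝ^{n−1}×ℝ and ξ = (ξ₀,ξ₁) ∈ ℝ^{n−1}×ℝ. Then ξ₁² = 1 + |ξ₀|² (so ξ₁ ≠ 0), and the map σ(x,ξ) = (x',ξ') with x' = (−x₁/ξ₁, x₀ − (x₁/ξ₁)ξ₀) and ξ' = (1/ξ₁, ξ₀/ξ₁) takes values in Uℝⁿ (i.e. |ξ'| = 1) and is injective. Moreover σ maps oriented spheres to oriented spheres: if p = (p₀,p₁) ∈ ℝ^{n−1}×ℝ, r ∈ ℝ and (x,ξ) ∈ H(p,r),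 then σ(x,ξ) ∈ S(p',r') where p' = (−r, p₀) ∈ ℝⁿ and r' = −p₁. -/
noncomputable section

/-- The Laguerre embedding `σ : Uℝⁿ₁ → Uℝⁿ`, acting on points
`((x₀,x₁),(ξ₀,ξ₁)) ∈ (ℝ^{n-1}×ℝ) × (ℝ^{n-1}×ℝ)`:
`σ(x,ξ) = ((-x₁/ξ₁, x₀ - (x₁/ξ₁)ξ₀), (1/ξ₁, ξ₀/ξ₁))`. -/
def sigmaMap (m : ℕ) (p : ((Fin m → ℝ) × ℝ) × ((Fin m → ℝ) × ℝ)) :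
    (ℝ × (Fin m → ℝ)) × (ℝ × (Fin m → ℝ)) :=
  ((-p.1.2 / p.2.2, p.1.1 - (p.1.2 / p.2.2) • p.2.1),
   (1 / p.2.2, (1 / p.2.2) • p.2.1))

theorem sq_eq_and_ne_zero_of_timelike {m : ℕ} (ξ₀ : Fin m → ℝ) (ξ₁ : ℝ)
    (h : (∑ i, ξ₀ i ^ 2) - ξ₁ ^ 2 = -1) : ξ₁ ^ 2 = 1 + ∑ i, ξ₀ i ^ 2 ∧ ξ₁ ≠ 0 := by
  have hs : 0 ≤ ∑ i, ξ₀ i ^ 2 := Finset.sum_nonneg fun i _ => sq_nonneg _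
  refine ⟨by linarith, ?_⟩
  rintro rfl
  linarith [zero_pow (M₀ := ℝ) two_ne_zero]

theorem sigmaMap_mem_unit {m : ℕ} (q : ((Fin m → ℝ) × ℝ) × ((Fin m → ℝ) × ℝ))
    (h : (∑ i, q.2.1 i ^ 2) - q.2.2 ^ 2 = -1) :
    (sigmaMap m q).2.1 ^ 2 + (∑ i, (sigmaMap m q).2.2 i ^ 2) = 1 := by
  obtain ⟨hsq, hne⟩ := sq_eq_and_ne_zero_of_timelike _ _ h
  simp only [sigmaMap, Pi.smul_apply, smul_eq_mul, mul_pow, ← Finset.mul_sum]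
  field_simp
  linarith

theorem sigmaMap_injective_of_ne_zero {m : ℕ} {q q' : ((Fin m → ℝ) × ℝ) × ((Fin m → ℝ) × ℝ)}
    (hq : q.2.2 ≠ 0) (h : sigmaMap m q = sigmaMap m q') : q = q' := by
  obtain ⟨⟨x₀, x₁⟩, ξ₀, ξ₁⟩ := q
  obtain ⟨⟨y₀, y₁⟩, η₀, η₁⟩ := q'
  simp only [sigmaMap, Prod.mk.injEq, one_div, inv_inj] at h hq
  obtain ⟨⟨hx₁, hx₀⟩, rfl, hξ₀⟩ := h
  obtain rfl : ξ₀ = η₀ := smul_right_injective _ (inv_ne_zero hq) hξ₀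
  obtain rfl : x₁ = y₁ := neg_injective ((div_left_inj' hq).1 hx₁)
  obtain rfl : x₀ = y₀ := sub_left_injective hx₀
  rfl

theorem sigmaMap_mem_sphere {m : ℕ} (x₀ ξ₀ p₀ : Fin m → ℝ) (x₁ ξ₁ p₁ r : ℝ) (hξ : ξ₁ ≠ 0)
    (hx₀ : x₀ - p₀ = r • ξ₀) (hx₁ : x₁ - p₁ = r * ξ₁) :
    (sigmaMap m ((x₀, x₁), (ξ₀, ξ₁))).1.1 - (-r)
        = (-p₁) * (sigmaMap m ((x₀, x₁), (ξ₀, ξ₁))).2.1 ∧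
      (sigmaMap m ((x₀, x₁), (ξ₀, ξ₁))).1.2 - p₀
        = (-p₁) • (sigmaMap m ((x₀, x₁), (ξ₀, ξ₁))).2.2 := by
  obtain rfl := eq_add_of_sub_eq hx₀
  obtain rfl := eq_add_of_sub_eq hx₁
  constructor
  · simp only [sigmaMap]
    field_simp
    ring
  · ext i
    simp only [sigmaMap, Pi.sub_apply, Pi.add_apply, Pi.smul_apply, smul_eq_mul]
    field_simp
    ring

/-- for `(x,ξ) ∈ Uℝⁿ₁` (so `|ξ₀|² - ξ₁² = -1`) we have
`ξ₁² = 1 + |ξ₀|²` (so `ξ₁ ≠ 0`); `σ` maps into `Uℝⁿ` (`|ξ'| = 1`); `σ` is injective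
on `Uℝⁿ₁`; and `σ` takes the oriented sphere `H(p,r)` into `S(p',r')` with
`p' = (-r, p₀)`, `r' = -p₁`. -/
theorem stmt15 (n : ℕ) (hn : 2 ≤ n) :
    (∀ (ξ₀ : Fin (n - 1) → ℝ) (ξ₁ : ℝ), (∑ i, ξ₀ i ^ 2) - ξ₁ ^ 2 = -1 →
      ξ₁ ^ 2 = 1 + ∑ i, ξ₀ i ^ 2 ∧ ξ₁ ≠ 0) ∧
    (∀ q : ((Fin (n - 1) → ℝ) × ℝ) × ((Fin (n - 1) → ℝ) × ℝ),
      (∑ i, q.2.1 i ^ 2) - q.2.2 ^ 2 = -1 →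
      ((sigmaMap (n - 1) q).2.1) ^ 2 + (∑ i, ((sigmaMap (n - 1) q).2.2 i) ^ 2) = 1) ∧
    (∀ q q' : ((Fin (n - 1) → ℝ) × ℝ) × ((Fin (n - 1) → ℝ) × ℝ),
      (∑ i, q.2.1 i ^ 2) - q.2.2 ^ 2 = -1 →
      (∑ i, q'.2.1 i ^ 2) - q'.2.2 ^ 2 = -1 →
      sigmaMap (n - 1) q = sigmaMap (n - 1) q' → q = q') ∧
    (∀ (x₀ ξ₀ p₀ : Fin (n - 1) → ℝ) (x₁ ξ₁ p₁ r : ℝ),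
      (∑ i, ξ₀ i ^ 2) - ξ₁ ^ 2 = -1 →
      x₀ - p₀ = r • ξ₀ → x₁ - p₁ = r * ξ₁ →
      (sigmaMap (n - 1) ((x₀, x₁), (ξ₀, ξ₁))).1.1 - (-r)
          = (-p₁) * (sigmaMap (n - 1) ((x₀, x₁), (ξ₀, ξ₁))).2.1 ∧
      (sigmaMap (n - 1) ((x₀, x₁), (ξ₀, ξ₁))).1.2 - p₀
          = (-p₁) • (sigmaMap (n - 1) ((x₀, x₁), (ξ₀, ξ₁))).2.2) := by
  exact ⟨sq_eq_and_ne_zero_of_timelike, sigmaMap_mem_unit,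
    fun q _ hq _ => sigmaMap_injective_of_ne_zero (sq_eq_and_ne_zero_of_timelike q.2.1 q.2.2 hq).2,
    fun x₀ ξ₀ p₀ x₁ ξ₁ p₁ r h =>
      sigmaMap_mem_sphere x₀ ξ₀ p₀ x₁ ξ₁ p₁ r (sq_eq_and_ne_zero_of_timelike ξ₀ ξ₁ h).2⟩
end
end

section
/- Let n ≥ 2 and let ν = (1,0,…,0,1) ∈ ℝ^{n+1} with the Lorentzian inner product ⟨X,Y⟩ = X₁Y₁ + ⋯ + XₙYₙ − X_{n+1}Y_{n+1}. For (x,ξ) ∈ Uℝⁿ₀ write x = (x₁, x₀, x₁) and ξ = (ξ₁+1, ξ₀, ξ₁) with x₀, ξ₀ ∈ ℝ^{n−1} and x₁, ξ₁ ∈ ℝ. Then ξ₁ ≤ −1/2 (in particular ξ₁ ≠ 0), and the map τ(x,ξ) = (x',ξ') with x' = (−x₁/ξ₁, x₀ − (x₁/ξ₁)ξ₀) and ξ' = (1 + 1/ξ₁, ξ₀/ξ₁) takes values in Uℝⁿ (i.e. |ξ'| = 1). Moreover τ maps oriented spheres to oriented spheres: if p ∈ ℝ^{n+1} with r := −⟨p,ν⟩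 and p = (p₁−r, p₀, p₁), and if (x,ξ) ∈ C(p), then τ(x,ξ) ∈ S(p',r') where p' = (p₁−r, p₀) ∈ ℝⁿ and r' = −p₁. -/
noncomputable section

/-- Let `(x,ξ) ∈ Uℝⁿ₀`, written (using `⟨x,ν⟩ = 0` and `⟨ξ,ν⟩ = 1`)
as `x = (x₁, x₀, x₁)` and `ξ = (ξ₁+1, ξ₀, ξ₁)` with `x₀, ξ₀ ∈ ℝ^{n-1}`, where the
condition `⟨ξ,ξ⟩ = 0` reads `(ξ₁+1)² + |ξ₀|² - ξ₁² = 0`.  Then `ξ₁ ≤ -1/2`; the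
image `τ(x,ξ) = (x',ξ')` with `x' = (-x₁/ξ₁, x₀ - (x₁/ξ₁)ξ₀)` and
`ξ' = (1 + 1/ξ₁, ξ₀/ξ₁)` satisfies `|ξ'| = 1`; and if `(x,ξ) ∈ C(p)` for
`p = (p₁-r, p₀, p₁)` with `r = -⟨p,ν⟩`, then `τ(x,ξ) ∈ S(p',r')` with
`p' = (p₁-r, p₀)` and `r' = -p₁`. -/
theorem stmt17 (n : ℕ) (hn : 2 ≤ n) (x₀ ξ₀ : Fin (n - 1) → ℝ) (x₁ ξ₁ : ℝ)
    (hξ : (ξ₁ + 1) ^ 2 + (∑ i, ξ₀ i ^ 2) - ξ₁ ^ 2 = 0) :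
    ξ₁ ≤ -(1 / 2) ∧
    (1 + 1 / ξ₁) ^ 2 + (∑ i, (ξ₀ i / ξ₁) ^ 2) = 1 ∧
    (∀ (p₀ : Fin (n - 1) → ℝ) (p₁ r : ℝ),
      x₁ - (p₁ - r) = r * (ξ₁ + 1) →
      x₀ - p₀ = r • ξ₀ →
      x₁ - p₁ = r * ξ₁ →
      (-x₁ / ξ₁) - (p₁ - r) = (-p₁) * (1 + 1 / ξ₁) ∧
      (x₀ - (x₁ / ξ₁) • ξ₀) - p₀ = (-p₁) • ((1 / ξ₁) • ξ₀)) := by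
  have hS : 0 ≤ ∑ i, ξ₀ i ^ 2 := Finset.sum_nonneg fun i _ => sq_nonneg _
  have hle : ξ₁ ≤ -(1 / 2) := by nlinarith
  have hne : ξ₁ ≠ 0 := by rintro rfl; norm_num at hle
  refine ⟨hle, ?_, fun p₀ p₁ r _ h₀ h₁ => ⟨?_, ?_⟩⟩
  · simp only [div_pow]
    rw [← Finset.sum_div]
    field_simp
    linarith
  · obtain rfl : x₁ = p₁ + r * ξ₁ := by linarith
    field_simp
    ring
  · obtain rfl : x₁ = p₁ + r * ξ₁ := by linarith
    funext i
    have hi : x₀ i - p₀ i = r * ξ₀ i := congrFun h₀ i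
    simp only [Pi.sub_apply, Pi.smul_apply, smul_eq_mul]
    have hx : x₀ i = p₀ i + r * ξ₀ i := by linarith
    rw [hx]
    field_simp
    ring
end
end
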